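/- Let (α_n) be a sequence with α_n > −1 such that α_n/n → ∞ as n → ∞. Then for every ξ with |ξ| ≤ 2, lim_{n→∞} (1/n)·N^{(α_n)}(√(n·α_n)·ξ + α_n) = (1/(2π)) · ∫_{−2}^{ξ} √(4−x²) dx. -/

import Mathlib

open Filter Topology

/-- Generalized binomial coefficient C(t, m) = t(t-1)⋯(t-m+1)/m! for real t. -/
noncomputable def genBinom (t : ℝ) (m : ℕ) : ℝ :=
  (∏ i ∈ Finset.range m, (t - (i : ℝ))) / (Nat.factorial m)

/-- Laguerre polynomial L_n^{(α)}. -/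
noncomputable def laguerreL (n : ℕ) (α : ℝ) (x : ℝ) : ℝ :=
  ∑ k ∈ Finset.range (n + 1),
    (-1) ^ k * genBinom ((n : ℝ) + α) (n - k) * x ^ k / (Nat.factorial k)

/-- Number of zeros of L_n^{(α)} that are ≤ ξ. -/
noncomputable def laguerreN (n : ℕ) (α ξ : ℝ) : ℕ :=
  {x : ℝ | laguerreL n α x = 0 ∧ x ≤ ξ}.ncard

/-- If `y'' = -q y` with `q > m ^ 2`, then `y` cannot be positive on an interval of length
`π / m`. -/
theorem sturm_not_pos {y y' q : ℝ → ℝ} {a m : ℝ} (hm : 0 < m)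
    (hy : ∀ x ∈ Set.Icc a (a + Real.pi / m), HasDerivAt y (y' x) x)
    (hy' : ∀ x ∈ Set.Icc a (a + Real.pi / m), HasDerivAt y' (-(q x * y x)) x)
    (hq : ∀ x ∈ Set.Icc a (a + Real.pi / m), m ^ 2 < q x)
    (hpos : ∀ x ∈ Set.Ioo a (a + Real.pi / m), 0 < y x) : False := by
  have hlen : 0 < Real.pi / m := div_pos Real.pi_pos hm
  have hab : a < a + Real.pi / m := by linarith
  have hcont : ContinuousOn y (Set.Icc a (a + Real.pi / m)) :=
    fun x hx => (hy x hx).continuousAt.continuousWithinAt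
  have hnonneg : ∀ x ∈ Set.Icc a (a + Real.pi / m), 0 ≤ y x := by
    intro x hx
    rw [← closure_Ioo hab.ne] at hx hcont
    exact le_on_closure (fun x hx => (hpos x hx).le) continuousOn_const hcont hx
  let W : ℝ → ℝ := fun x => y x * (m * Real.cos (m * (x - a))) - y' x * Real.sin (m * (x - a))
  have hW : ∀ x ∈ Set.Icc a (a + Real.pi / m),
      HasDerivAt W ((q x - m ^ 2) * y x * Real.sin (m * (x - a))) x := by
    intro x hx
    have hlin : HasDerivAt (fun x : ℝ => m * (x - a)) m x := by
      simpa using ((hasDerivAt_id x).sub_const a).const_mul m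
    have h := ((hy x hx).mul (hlin.cos.const_mul m)).sub ((hy' x hx).mul hlin.sin)
    refine h.congr_deriv ?_
    ring
  have hmono : StrictMonoOn W (Set.Icc a (a + Real.pi / m)) := by
    refine strictMonoOn_of_deriv_pos (convex_Icc _ _)
      (fun x hx => (hW x hx).continuousAt.continuousWithinAt) ?_
    intro x hx
    rw [interior_Icc] at hx
    have hx' := Set.Ioo_subset_Icc_self hx
    rw [(hW x hx').deriv]
    have hs : 0 < Real.sin (m * (x - a)) := by
      apply Real.sin_pos_of_pos_of_lt_pi (mul_pos hm (by linarith [hx.1]))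
      have : x - a < Real.pi / m := by linarith [hx.2]
      rw [lt_div_iff₀ hm] at this
      linarith
    exact mul_pos (mul_pos (by linarith [hq x hx']) (hpos x hx)) hs
  have ha : a ∈ Set.Icc a (a + Real.pi / m) := Set.left_mem_Icc.2 hab.le
  have hb : a + Real.pi / m ∈ Set.Icc a (a + Real.pi / m) := Set.right_mem_Icc.2 hab.le
  have hlt := hmono ha hb hab
  have hend : m * (a + Real.pi / m - a) = Real.pi := by field_simp; ring
  simp only [W, hend, sub_self, mul_zero, Real.cos_zero, Real.sin_zero, Real.cos_pi,
    Real.sin_pi] at hlt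
  have h1 := mul_nonneg (hnonneg _ ha) hm.le
  have h2 := mul_nonneg (hnonneg _ hb) hm.le
  linarith

/-- Sturm comparison with `sin`: a solution of `y'' = -q y` with `q > m ^ 2` vanishes inside every
interval of length `π / m`. -/
theorem sturm_exists_zero {y y' q : ℝ → ℝ} {a m : ℝ} (hm : 0 < m)
    (hy : ∀ x ∈ Set.Icc a (a + Real.pi / m), HasDerivAt y (y' x) x)
    (hy' : ∀ x ∈ Set.Icc a (a + Real.pi / m), HasDerivAt y' (-(q x * y x)) x)
    (hq : ∀ x ∈ Set.Icc a (a + Real.pi / m), m ^ 2 < q x) :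
    ∃ x ∈ Set.Ioo a (a + Real.pi / m), y x = 0 := by
  by_contra! hne
  have hcont : ContinuousOn y (Set.Ioo a (a + Real.pi / m)) :=
    fun x hx => (hy x (Set.Ioo_subset_Icc_self hx)).continuousAt.continuousWithinAt
  have hsign : (∀ x ∈ Set.Ioo a (a + Real.pi / m), 0 < y x) ∨
      ∀ x ∈ Set.Ioo a (a + Real.pi / m), y x < 0 := by
    by_contra! h
    obtain ⟨⟨u, hu, hyu⟩, v, hv, hyv⟩ := h
    obtain ⟨x, hx, hx0⟩ := isPreconnected_Ioo.intermediate_value hu hv hcont ⟨hyu, hyv⟩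
    exact hne x hx hx0
  rcases hsign with h | h
  · exact sturm_not_pos hm hy hy' hq h
  · refine sturm_not_pos (y := fun x => -y x) (y' := fun x => -y' x) (q := q) hm
      (fun x hx => (hy x hx).neg) (fun x hx => ?_) hq (fun x hx => neg_pos.2 (h x hx))
    refine (hy' x hx).neg.congr_deriv ?_
    ring

/-- A finite set meeting each of `k` consecutive intervals of length `d` has at least `k` points
in their union. -/
theorem le_ncard_of_forall_exists_mem_Ioo {Z : Set ℝ} (hZ : Z.Finite) {a b d : ℝ} (hd : 0 < d)
    {k : ℕ} (hk : a + k * d ≤ b)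
    (h : ∀ i : ℕ, i < k → ∃ x ∈ Set.Ioo (a + i * d) (a + i * d + d), x ∈ Z) :
    k ≤ {x | x ∈ Z ∧ a < x ∧ x ≤ b}.ncard := by
  choose z hz hzZ using fun i : Fin k => h i i.2
  have hmono : StrictMono z := by
    intro i j hij
    have hij' : ((i : ℕ) : ℝ) + 1 ≤ (j : ℕ) := by exact_mod_cast hij
    have := mul_le_mul_of_nonneg_right hij' hd.le
    linarith [(hz i).2, (hz j).1]
  calc k = (Set.range z).ncard := by
        rw [← Set.image_univ, Set.ncard_image_of_injective _ hmono.injective]; simp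
    _ ≤ _ := by
        refine Set.ncard_le_ncard ?_ (hZ.subset fun x hx => hx.1)
        rintro _ ⟨i, rfl⟩
        have h0 : 0 ≤ ((i : ℕ) : ℝ) * d := by positivity
        have hik : ((i : ℕ) : ℝ) + 1 ≤ k := by exact_mod_cast i.2
        have := mul_le_mul_of_nonneg_right hik hd.le
        exact ⟨hzZ i, by linarith [(hz i).1], by linarith [(hz i).2]⟩

/-- The Laguerre polynomial as a formal polynomial. -/
noncomputable def laguerrePoly (n : ℕ) (α : ℝ) : Polynomial ℝ :=
  ∑ k ∈ Finset.range (n + 1),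
    Polynomial.C ((-1) ^ k * genBinom ((n : ℝ) + α) (n - k) / (Nat.factorial k)) *
      Polynomial.X ^ k

theorem laguerrePoly_eval (n : ℕ) (α x : ℝ) : (laguerrePoly n α).eval x = laguerreL n α x := by
  simp only [laguerrePoly, laguerreL, Polynomial.eval_finsetSum, Polynomial.eval_mul,
    Polynomial.eval_C, Polynomial.eval_pow, Polynomial.eval_X]
  exact Finset.sum_congr rfl fun k _ => by ring

theorem laguerrePoly_coeff (n : ℕ) (α : ℝ) (k : ℕ) : (laguerrePoly n α).coeff k =
    if k ≤ n then (-1) ^ k * genBinom ((n : ℝ) + α) (n - k) / (Nat.factorial k) else 0 := by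
  simp [laguerrePoly, Polynomial.finsetSum_coeff, Polynomial.coeff_C_mul, Polynomial.coeff_X_pow]

theorem laguerrePoly_ne_zero (n : ℕ) (α : ℝ) : laguerrePoly n α ≠ 0 := by
  intro h
  have := laguerrePoly_coeff n α n
  simp only [h, genBinom, Polynomial.coeff_zero, le_refl, if_true, Nat.sub_self,
    Finset.range_zero, Finset.prod_empty, Nat.factorial_zero, Nat.cast_one, div_one, mul_one] at this
  exact absurd this.symm (by positivity)

theorem laguerrePoly_natDegree_le (n : ℕ) (α : ℝ) : (laguerrePoly n α).natDegree ≤ n := by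
  rw [Polynomial.natDegree_le_iff_coeff_eq_zero]
  intro k hk
  rw [laguerrePoly_coeff, if_neg (by omega)]

theorem genBinom_succ (t : ℝ) (m : ℕ) :
    genBinom t (m + 1) * (m + 1) = genBinom t m * (t - m) := by
  have : (Nat.factorial m : ℝ) ≠ 0 := by positivity
  simp only [genBinom, Finset.prod_range_succ, Nat.factorial_succ]
  push_cast
  field_simp

theorem laguerrePoly_coeff_succ (n : ℕ) (α : ℝ) (k : ℕ) :
    ((k : ℝ) + 1) * (k + 1 + α) * (laguerrePoly n α).coeff (k + 1) =
      -((n - k) * (laguerrePoly n α).coeff k) := by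
  rw [laguerrePoly_coeff, laguerrePoly_coeff]
  rcases lt_trichotomy k n with h | rfl | h
  · obtain ⟨m, rfl⟩ := Nat.exists_eq_add_of_lt h
    rw [if_pos (by omega), if_pos (by omega), show k + m + 1 - (k + 1) = m by omega,
      show k + m + 1 - k = m + 1 by omega]
    have hrec := genBinom_succ ((k + m + 1 : ℕ) + α) m
    have : (Nat.factorial k : ℝ) ≠ 0 := by positivity
    rw [Nat.factorial_succ, pow_succ]
    push_cast at hrec ⊢
    field_simp
    linear_combination hrec
  · simp
  · rw [if_neg (by omega), if_neg (by omega)]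
    simp

/-- Laguerre's differential equation. -/
theorem laguerrePoly_ode (n : ℕ) (α x : ℝ) :
    x * (laguerrePoly n α).derivative.derivative.eval x +
      (α + 1 - x) * (laguerrePoly n α).derivative.eval x + n * (laguerrePoly n α).eval x = 0 := by
  have h : Polynomial.X * (laguerrePoly n α).derivative.derivative +
      Polynomial.C (α + 1) * (laguerrePoly n α).derivative -
      Polynomial.X * (laguerrePoly n α).derivative +
      Polynomial.C (n : ℝ) * laguerrePoly n α = 0 := by
    ext k
    cases k with
    | zero =>
      have := laguerrePoly_coeff_succ n α 0
      simp only [Polynomial.coeff_add, Polynomial.coeff_sub, Polynomial.coeff_C_mul,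
        Polynomial.coeff_X_mul_zero, Polynomial.coeff_derivative, Polynomial.coeff_zero]
      push_cast at this ⊢
      linear_combination this
    | succ k =>
      have := laguerrePoly_coeff_succ n α (k + 1)
      simp only [Polynomial.coeff_add, Polynomial.coeff_sub, Polynomial.coeff_C_mul,
        Polynomial.coeff_X_mul, Polynomial.coeff_derivative, Polynomial.coeff_zero]
      push_cast at this ⊢
      linear_combination this
  have := congrArg (Polynomial.eval x) h
  simp only [Polynomial.eval_add, Polynomial.eval_sub, Polynomial.eval_mul, Polynomial.eval_X,
    Polynomial.eval_C, Polynomial.eval_zero] at this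
  linear_combination this

theorem laguerreL_zeros_finite (n : ℕ) (α : ℝ) : {x | laguerreL n α x = 0}.Finite := by
  simp only [← laguerrePoly_eval]
  exact Polynomial.finite_setOfPred_isRoot (laguerrePoly_ne_zero n α)

theorem laguerreL_zeros_ncard_le (n : ℕ) (α : ℝ) : {x | laguerreL n α x = 0}.ncard ≤ n := by
  have : {x | laguerreL n α x = 0} = ((laguerrePoly n α).roots.toFinset : Set ℝ) := by
    ext x
    simp [laguerrePoly_ne_zero, Polynomial.IsRoot, laguerrePoly_eval]
  rw [this, Set.ncard_coe_finset]
  exact (Multiset.toFinset_card_le _).trans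
    ((Polynomial.card_roots' _).trans (laguerrePoly_natDegree_le n α))

/-- If the potential in the normal form of Laguerre's equation exceeds `m ^ 2`, then the Laguerre
polynomial vanishes inside every interval of length `π / m`. -/
theorem laguerreL_exists_zero {n : ℕ} {α a m : ℝ} (hm : 0 < m) (ha : 0 < a)
    (hq : ∀ x ∈ Set.Icc a (a + Real.pi / m),
      m ^ 2 < (-(x - α) ^ 2 + (4 * n + 2) * x + 1) / (4 * x ^ 2)) :
    ∃ x ∈ Set.Ioo a (a + Real.pi / m), laguerreL n α x = 0 := by
  set P := laguerrePoly n α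
  let g : ℝ → ℝ := fun x => Real.exp (-x / 2) * x ^ ((α + 1) / 2)
  let h : ℝ → ℝ := fun x => -1 / 2 + (α + 1) / 2 * x⁻¹
  have hg : ∀ x, 0 < x → HasDerivAt g (g x * h x) x := by
    intro x hx
    have h1 : HasDerivAt (fun x : ℝ => Real.exp (-x / 2)) (Real.exp (-x / 2) * (-1 / 2)) x :=
      ((hasDerivAt_id x).neg.div_const 2).exp
    refine (h1.mul (Real.hasDerivAt_rpow_const (p := (α + 1) / 2) (Or.inl hx.ne'))).congr_deriv ?_
    simp only [g, h]
    rw [Real.rpow_sub_one hx.ne']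
    field_simp
  have hh : ∀ x, 0 < x → HasDerivAt h ((α + 1) / 2 * -(x ^ 2)⁻¹) x := fun x hx =>
    ((hasDerivAt_inv hx.ne').const_mul _).const_add _
  obtain ⟨x, hx, hx0⟩ := sturm_exists_zero (y := fun x => g x * P.eval x)
    (y' := fun x => g x * (h x * P.eval x + P.derivative.eval x)) hm
    (q := fun x => (-(x - α) ^ 2 + (4 * n + 2) * x + 1) / (4 * x ^ 2))
    (fun x hx => by
      have hx0 : 0 < x := ha.trans_le hx.1
      refine ((hg x hx0).mul (P.hasDerivAt x)).congr_deriv ?_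
      ring)
    (fun x hx => by
      have hx0 : 0 < x := ha.trans_le hx.1
      refine ((hg x hx0).mul (((hh x hx0).mul (P.hasDerivAt x)).add
        (P.derivative.hasDerivAt x))).congr_deriv ?_
      have hode : P.derivative.derivative.eval x =
          (-(α + 1 - x) * P.derivative.eval x - n * P.eval x) / x := by
        rw [eq_div_iff hx0.ne']
        linear_combination laguerrePoly_ode n α x
      rw [hode]
      simp only [h, Pi.add_apply, Pi.mul_apply]
      field_simp
      ring)
    hq
  refine ⟨x, hx, ?_⟩
  have hx' : 0 < x := ha.trans hx.1
  have hgx : g x ≠ 0 := (mul_pos (Real.exp_pos _) (Real.rpow_pos_of_pos hx' _)).ne'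
  rw [← laguerrePoly_eval]
  exact (mul_eq_zero.1 hx0).resolve_left hgx

/-- The number of zeros of `L_n^{(α)}` in `(u, v]`. -/
noncomputable def laguerreCount (n : ℕ) (α u v : ℝ) : ℕ :=
  {x | x ∈ {x | laguerreL n α x = 0} ∧ u < x ∧ x ≤ v}.ncard

theorem laguerreCount_add {n : ℕ} {α u v w : ℝ} (huv : u ≤ v) (hvw : v ≤ w) :
    laguerreCount n α u v + laguerreCount n α v w = laguerreCount n α u w := by
  have hfin := laguerreL_zeros_finite n α
  rw [laguerreCount, laguerreCount, laguerreCount,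
    ← Set.ncard_union_eq _ (hfin.subset fun x hx => hx.1) (hfin.subset fun x hx => hx.1)]
  · congr 1
    ext x
    constructor
    · rintro (⟨h, h1, h2⟩ | ⟨h, h1, h2⟩)
      · exact ⟨h, h1, h2.trans hvw⟩
      · exact ⟨h, huv.trans_lt h1, h2⟩
    · rintro ⟨h, h1, h2⟩
      rcases le_or_gt x v with hx | hx
      · exact Or.inl ⟨h, h1, hx⟩
      · exact Or.inr ⟨h, hx, h2⟩
  · rw [Set.disjoint_left]
    rintro x ⟨-, -, h⟩ ⟨-, h', -⟩
    linarith

theorem laguerreCount_le_laguerreN (n : ℕ) (α u v : ℝ) :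
    laguerreCount n α u v ≤ laguerreN n α v :=
  Set.ncard_le_ncard (fun _ hx => ⟨hx.1, hx.2.2⟩)
    ((laguerreL_zeros_finite n α).subset fun _ hx => hx.1)

theorem laguerreN_add_laguerreCount_le (n : ℕ) (α u v : ℝ) :
    laguerreN n α u + laguerreCount n α u v ≤ n := by
  have hfin := laguerreL_zeros_finite n α
  refine le_trans ?_ (laguerreL_zeros_ncard_le n α)
  rw [laguerreN, laguerreCount,
    ← Set.ncard_union_eq _ (hfin.subset fun x hx => hx.1) (hfin.subset fun x hx => hx.1)]
  · refine Set.ncard_le_ncard ?_ hfin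
    rintro x (hx | hx) <;> exact hx.1
  · rw [Set.disjoint_left]
    rintro x ⟨-, h⟩ ⟨-, h', -⟩
    linarith

/-- Lower bound for the rescaled potential in the normal form of Laguerre's equation. -/
theorem le_rescaled_potential {n A s t ε : ℝ} (hA : 0 < A) (hs : 0 ≤ s) (hsA : s ^ 2 = n * A)
    (hr : s ≤ 1 / 4 * A) (hrε : s ≤ ε / 32 * A) (ht : |t| ≤ 2) :
    n ^ 2 * ((4 - t ^ 2) / 4 - ε) ≤
      s ^ 2 * ((-(A + s * t - A) ^ 2 + (4 * n + 2) * (A + s * t) + 1) / (4 * (A + s * t) ^ 2)) := by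
  obtain ⟨r, rfl⟩ : ∃ r, s = r * A := ⟨s / A, by field_simp⟩
  obtain rfl : n = r ^ 2 * A := by
    apply mul_right_cancel₀ hA.ne'
    linear_combination -hsA
  have hr0 : 0 ≤ r := nonneg_of_mul_nonneg_left hs hA
  have hr1 : r ≤ 1 / 4 := le_of_mul_le_mul_right hr hA
  have hr2 : r ≤ ε / 32 := le_of_mul_le_mul_right hrε hA
  obtain ⟨ht1, ht2⟩ := abs_le.1 ht
  obtain ⟨u, hu⟩ : ∃ u, u = 1 + r * t := ⟨_, rfl⟩
  have hu1 : 1 / 2 ≤ u := by nlinarith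
  have hu2 : u ≤ 3 / 2 := by nlinarith
  have hx : A + r * A * t = A * u := by rw [hu]; ring
  have hd : 0 < 4 * (A * u) ^ 2 := by positivity
  have key : u ^ 2 * (4 - t ^ 2 - 4 * ε) ≤ 4 * u - t ^ 2 := by
    have h1 : |r * t| ≤ 2 * r := by
      rw [abs_mul, abs_of_nonneg hr0]; nlinarith
    have ht4 : t ^ 2 ≤ 4 := by nlinarith
    have h2 : |4 * u - t ^ 2 * (1 + u)| ≤ 16 := by
      rw [abs_le]; constructor <;> nlinarith [sq_nonneg t]
    have h3 : |r * t * (4 * u - t ^ 2 * (1 + u))| ≤ 2 * r * 16 := by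
      rw [abs_mul]
      exact mul_le_mul h1 h2 (abs_nonneg _) (by positivity)
    have h4 : 1 / 4 ≤ u ^ 2 := by nlinarith
    have h5 : ε * (1 / 4) ≤ ε * u ^ 2 := mul_le_mul_of_nonneg_left h4 (by linarith)
    have h6 := (abs_le.1 h3).2
    have h7 : r * t = u - 1 := by rw [hu]; ring
    rw [h7] at h6
    nlinarith
  rw [hx, ← mul_div_assoc, le_div_iff₀ hd]
  have hmul := mul_le_mul_of_nonneg_left key (show 0 ≤ r ^ 4 * A ^ 4 by positivity)
  have hpos : 0 ≤ (r * A) ^ 2 * (2 * (A * u) + 1) := by positivity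
  have hxA : A * u - A = r * A * t := by rw [hu]; ring
  rw [hxA]
  nlinarith

theorem le_laguerreCount {n : ℕ} {A s a b μ : ℝ} (hn : 0 < n) (hs : 0 < s) (hμ : 0 < μ)
    (hab : a ≤ b) (ha : 0 < A + s * a)
    (hq : ∀ t ∈ Set.Icc a b, (n * μ) ^ 2 <
      s ^ 2 * ((-(A + s * t - A) ^ 2 + (4 * n + 2) * (A + s * t) + 1) / (4 * (A + s * t) ^ 2))) :
    (b - a) * (n * μ) / Real.pi - 1 ≤ laguerreCount n A (A + s * a) (A + s * b) := by
  have hn' : (0 : ℝ) < n := Nat.cast_pos.2 hn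
  have hm : 0 < n * μ / s := by positivity
  set d := Real.pi / (n * μ / s) with hd
  have hd0 : 0 < d := div_pos Real.pi_pos hm
  have hba : 0 ≤ b - a := sub_nonneg.2 hab
  have hT : 0 ≤ (b - a) * (n * μ) / Real.pi := by positivity
  set k := ⌊(b - a) * (n * μ) / Real.pi⌋₊ with hk
  have hTd : (b - a) * (n * μ) / Real.pi * d = s * (b - a) := by
    rw [hd]; field_simp
  have hkd : (k : ℝ) * d ≤ s * (b - a) := by
    rw [← hTd]
    exact mul_le_mul_of_nonneg_right (Nat.floor_le hT) hd0.le
  have hle : k ≤ laguerreCount n A (A + s * a) (A + s * b) := by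
    refine le_ncard_of_forall_exists_mem_Ioo (laguerreL_zeros_finite n A) hd0 (by linarith) ?_
    intro i hi
    have hi0 : 0 ≤ (i : ℝ) * d := by positivity
    have hik : (i : ℝ) + 1 ≤ k := by exact_mod_cast hi
    have hikd := mul_le_mul_of_nonneg_right hik hd0.le
    refine laguerreL_exists_zero hm (by linarith) ?_
    intro x hx
    rw [← hd] at hx
    obtain ⟨t, rfl⟩ : ∃ t, x = A + s * t := ⟨(x - A) / s, by field_simp; ring⟩
    have hta : a ≤ t := le_of_mul_le_mul_left (by linarith [hx.1]) hs
    have htb : t ≤ b := le_of_mul_le_mul_left (by linarith [hx.2]) hs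
    rw [div_pow, div_lt_iff₀ (by positivity)]
    linarith [hq t ⟨hta, htb⟩]
  have hlt := Nat.lt_floor_add_one ((b - a) * (n * μ) / Real.pi)
  have hle' : (k : ℝ) ≤ laguerreCount n A (A + s * a) (A + s * b) := by exact_mod_cast hle
  linarith

theorem eventually_sqrt_le {α : ℕ → ℝ} (hα : Tendsto (fun n : ℕ => α n / n) atTop atTop)
    {η : ℝ} (hη : 0 < η) :
    ∀ᶠ n : ℕ in atTop, 0 < n ∧ 0 < α n ∧ Real.sqrt (n * α n) ≤ η * α n := by
  filter_upwards [eventually_gt_atTop 0, hα.eventually_ge_atTop (1 / η ^ 2)] with n hn h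
  have hn' : (0 : ℝ) < n := Nat.cast_pos.2 hn
  rw [le_div_iff₀ hn'] at h
  have hpos : 0 < α n := lt_of_lt_of_le (by positivity) h
  refine ⟨hn, hpos, Real.sqrt_le_iff.2 ⟨by positivity, ?_⟩⟩
  have h' : (n : ℝ) ≤ η ^ 2 * α n := by
    rw [div_mul_eq_mul_div, one_mul, div_le_iff₀ (by positivity)] at h
    linarith
  nlinarith

/-- Lower bound for the number of zeros on an interval where `√(4 - t ^ 2)` oscillates little. -/
theorem eventually_le_laguerreCount_of_oscillation {α : ℕ → ℝ}
    (hα : Tendsto (fun n : ℕ => α n / n) atTop atTop) {a b ε : ℝ} (hε : 0 < ε)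
    (ha : -2 ≤ a) (hab : a ≤ b) (hb : b ≤ 2)
    (hosc : ∀ t ∈ Set.Icc a b, |Real.sqrt (4 - t ^ 2) - Real.sqrt (4 - a ^ 2)| ≤ ε) :
    ∀ᶠ n : ℕ in atTop,
      n * ((∫ t in a..b, Real.sqrt (4 - t ^ 2)) - 4 * ε * (b - a)) / (2 * Real.pi) ≤
      laguerreCount n (α n) (α n + Real.sqrt (n * α n) * a) (α n + Real.sqrt (n * α n) * b) := by
  obtain ⟨μ, hμ⟩ : ∃ μ, μ = (Real.sqrt (4 - a ^ 2) - 2 * ε) / 2 := ⟨_, rfl⟩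
  have hcont : Continuous fun t : ℝ => Real.sqrt (4 - t ^ 2) := by fun_prop
  have hint : (∫ t in a..b, Real.sqrt (4 - t ^ 2)) ≤ (2 * μ + 3 * ε) * (b - a) := by
    calc _ ≤ ∫ _ in a..b, (2 * μ + 3 * ε) := by
          refine intervalIntegral.integral_mono_on hab (hcont.intervalIntegrable _ _)
            intervalIntegrable_const fun t ht => ?_
          linarith [(abs_le.1 (hosc t ht)).2]
      _ = _ := by rw [intervalIntegral.integral_const, smul_eq_mul, mul_comm]
  have hint' : (∫ t in a..b, Real.sqrt (4 - t ^ 2)) - 4 * ε * (b - a) ≤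
      (2 * μ - ε) * (b - a) := by linarith
  rcases le_or_gt μ 0 with hμ0 | hμ0
  · refine Eventually.of_forall fun n => le_trans ?_ (Nat.cast_nonneg _)
    refine div_nonpos_of_nonpos_of_nonneg (mul_nonpos_of_nonneg_of_nonpos (Nat.cast_nonneg _)
      (hint'.trans (mul_nonpos_of_nonpos_of_nonneg (by linarith) (by linarith)))) (by positivity)
  rcases hab.eq_or_lt with rfl | hab'
  · exact Eventually.of_forall fun n => by simp
  have hba : 0 < b - a := sub_pos.2 hab'
  filter_upwards [eventually_sqrt_le hα (show (0 : ℝ) < 1 / 4 by norm_num),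
    eventually_sqrt_le hα (show 0 < ε ^ 2 / 8 / 32 by positivity),
    tendsto_natCast_atTop_atTop.eventually_ge_atTop (2 * Real.pi / (ε * (b - a)))]
    with n ⟨hn, hA, hr⟩ ⟨_, _, hrε⟩ hlarge
  have hn' : (0 : ℝ) < n := Nat.cast_pos.2 hn
  have hs : 0 < Real.sqrt (n * α n) := Real.sqrt_pos.2 (by positivity)
  have hcount := le_laguerreCount (A := α n) (μ := μ) hn hs hμ0 hab (by nlinarith)
    (fun t ht => by
      have ht2 : |t| ≤ 2 := abs_le.2 ⟨ha.trans ht.1, ht.2.trans hb⟩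
      refine lt_of_lt_of_le ?_
        (le_rescaled_potential hA hs.le (Real.sq_sqrt (by positivity)) hr hrε ht2)
      rw [mul_pow]
      refine mul_lt_mul_of_pos_left ?_ (by positivity)
      have hφ : 2 * μ + ε ≤ Real.sqrt (4 - t ^ 2) := by linarith [(abs_le.1 (hosc t ht)).1]
      have hsq : Real.sqrt (4 - t ^ 2) ^ 2 = 4 - t ^ 2 :=
        Real.sq_sqrt (by nlinarith [abs_le.1 ht2])
      have := pow_le_pow_left₀ (by positivity) hφ 2
      nlinarith [mul_pos hμ0 hε, pow_pos hε 2])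
  refine le_trans ?_ hcount
  rw [div_le_iff₀ (by positivity)] at hlarge
  rw [div_le_iff₀ (by positivity)]
  have h1 := mul_le_mul_of_nonneg_left hint' hn'.le
  have h2 : ((b - a) * (n * μ) / Real.pi - 1) * (2 * Real.pi) =
      2 * ((b - a) * (n * μ)) - 2 * Real.pi := by
    field_simp
  rw [h2]
  linarith

/-- Asymptotic lower bound for the number of rescaled zeros in a subinterval of `[-2, 2]`. -/
theorem eventually_le_laguerreCount {α : ℕ → ℝ}
    (hα : Tendsto (fun n : ℕ => α n / n) atTop atTop) {ε : ℝ} (hε : 0 < ε) {a b : ℝ}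
    (ha : -2 ≤ a) (hab : a ≤ b) (hb : b ≤ 2) :
    ∀ᶠ n : ℕ in atTop,
      n * ((∫ t in a..b, Real.sqrt (4 - t ^ 2)) - 4 * ε * (b - a)) / (2 * Real.pi) ≤
      laguerreCount n (α n) (α n + Real.sqrt (n * α n) * a) (α n + Real.sqrt (n * α n) * b) := by
  have hcont : Continuous fun t : ℝ => Real.sqrt (4 - t ^ 2) := by fun_prop
  obtain ⟨δ, hδ, huc⟩ := Metric.uniformContinuousOn_iff.1
    ((isCompact_Icc (a := (-2 : ℝ)) (b := 2)).uniformContinuousOn_of_continuous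
      hcont.continuousOn) ε hε
  have hlocal : ∀ c d : ℝ, -2 ≤ c → c ≤ d → d ≤ 2 → d - c < δ → ∀ᶠ n : ℕ in atTop,
      n * ((∫ t in c..d, Real.sqrt (4 - t ^ 2)) - 4 * ε * (d - c)) / (2 * Real.pi) ≤
      laguerreCount n (α n) (α n + Real.sqrt (n * α n) * c)
        (α n + Real.sqrt (n * α n) * d) := by
    intro c d hc hcd hd hlt
    refine eventually_le_laguerreCount_of_oscillation hα hε hc hcd hd fun t ht => ?_
    refine (huc t ⟨hc.trans ht.1, ht.2.trans hd⟩ c ⟨hc, hcd.trans hd⟩ ?_).le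
    rw [Real.dist_eq, abs_of_nonneg (sub_nonneg.2 ht.1)]
    linarith [ht.2]
  have hinduct : ∀ k : ℕ, ∀ d : ℝ, a ≤ d → d ≤ 2 → d - a ≤ k * (δ / 2) → ∀ᶠ n : ℕ in atTop,
      n * ((∫ t in a..d, Real.sqrt (4 - t ^ 2)) - 4 * ε * (d - a)) / (2 * Real.pi) ≤
      laguerreCount n (α n) (α n + Real.sqrt (n * α n) * a)
        (α n + Real.sqrt (n * α n) * d) := by
    intro k
    induction k with
    | zero =>
      intro d had hd hk
      refine hlocal a d ha had hd ?_
      simp only [Nat.cast_zero, zero_mul] at hk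
      linarith
    | succ k ih =>
      intro d had hd hk
      rcases lt_or_ge (d - a) δ with h | h
      · exact hlocal a d ha had hd h
      push_cast at hk
      filter_upwards [ih (d - δ / 2) (by linarith) (by linarith) (by linarith),
        hlocal (d - δ / 2) d (by linarith) (by linarith) hd (by linarith)] with n h1 h2
      have hs := Real.sqrt_nonneg (n * α n)
      rw [← laguerreCount_add (v := α n + Real.sqrt (n * α n) * (d - δ / 2))
          (by nlinarith) (by nlinarith),
        ← intervalIntegral.integral_add_adjacent_intervals (b := d - δ / 2)
          (hcont.intervalIntegrable _ _) (hcont.intervalIntegrable _ _)]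
      push_cast
      refine le_trans (le_of_eq ?_) (add_le_add h1 h2)
      ring
  obtain ⟨k, hk⟩ := exists_nat_ge ((b - a) / (δ / 2))
  exact hinduct k b hab hb ((div_le_iff₀ (by positivity)).1 hk)

theorem integral_sqrt_four_sub_sq :
    (∫ t in (-2 : ℝ)..2, Real.sqrt (4 - t ^ 2)) = 2 * Real.pi := by
  have h := intervalIntegral.smul_integral_comp_mul_left
    (a := -1) (b := 1) (fun t : ℝ => Real.sqrt (4 - t ^ 2)) 2
  norm_num at h
  rw [← h]
  have h2 : ∀ t : ℝ, Real.sqrt (4 - (2 * t) ^ 2) = 2 * Real.sqrt (1 - t ^ 2) := by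
    intro t
    rw [show 4 - (2 * t) ^ 2 = 2 ^ 2 * (1 - t ^ 2) by ring, Real.sqrt_mul (by norm_num),
      Real.sqrt_sq (by norm_num)]
  simp only [h2, intervalIntegral.integral_const_mul, integral_sqrt_one_sub_sq]
  ring

theorem stmt7 (α : ℕ → ℝ)
    (hα : ∀ n, α n > -1)
    (hαlim : Tendsto (fun n : ℕ => α n / n) atTop atTop)
    (ξ : ℝ) (hξ : |ξ| ≤ 2) :
    Tendsto (fun n : ℕ =>
        (laguerreN n (α n) (Real.sqrt ((n : ℝ) * α n) * ξ + α n) : ℝ) / n)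
      atTop (𝓝 (1 / (2 * Real.pi) *
        ∫ x in (-2 : ℝ)..ξ, Real.sqrt (4 - x ^ 2))) := by
  obtain ⟨hξ1, hξ2⟩ := abs_le.1 hξ
  have hcont : Continuous fun t : ℝ => Real.sqrt (4 - t ^ 2) := by fun_prop
  have hsplit := intervalIntegral.integral_add_adjacent_intervals
    (hcont.intervalIntegrable (-2) ξ) (hcont.intervalIntegrable (μ := MeasureTheory.volume) ξ 2)
  rw [integral_sqrt_four_sub_sq] at hsplit
  have hπ := Real.pi_gt_three
  rw [Metric.tendsto_nhds]
  intro ε hε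
  filter_upwards [eventually_gt_atTop 0,
    eventually_le_laguerreCount hαlim (show 0 < ε / 4 by positivity) le_rfl hξ1 hξ2,
    eventually_le_laguerreCount hαlim (show 0 < ε / 4 by positivity) hξ1 hξ2 le_rfl]
    with n hn h1 h2
  have hn' : (0 : ℝ) < n := Nat.cast_pos.2 hn
  rw [add_comm (Real.sqrt (n * α n) * ξ)]
  have hle : (_ : ℝ) ≤ _ := Nat.cast_le.2 (laguerreCount_le_laguerreN n (α n)
    (α n + Real.sqrt (n * α n) * -2) (α n + Real.sqrt (n * α n) * ξ))
  have hge : (_ : ℝ) ≤ _ := Nat.cast_le.2 (laguerreN_add_laguerreCount_le n (α n)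
    (α n + Real.sqrt (n * α n) * ξ) (α n + Real.sqrt (n * α n) * 2))
  push_cast at hge
  set N : ℝ := (laguerreN n (α n) (α n + Real.sqrt (n * α n) * ξ) : ℝ)
  set I : ℝ := ∫ t in (-2 : ℝ)..ξ, Real.sqrt (4 - t ^ 2)
  rw [← eq_sub_iff_add_eq'] at hsplit
  rw [hsplit] at h2
  have hlow : n * (I - 4 * ε) / (2 * Real.pi) ≤ N := by
    refine le_trans ?_ (h1.trans hle)
    have : I - 4 * ε ≤ I - 4 * (ε / 4) * (ξ - -2) := by nlinarith
    gcongr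
  have hup : N ≤ n * (I + 4 * ε) / (2 * Real.pi) := by
    have h3 : n - n * (I + 4 * ε) / (2 * Real.pi) =
        n * (2 * Real.pi - I - 4 * ε) / (2 * Real.pi) := by
      field_simp
      ring
    have h4 : n * (2 * Real.pi - I - 4 * ε) / (2 * Real.pi) ≤
        n * (2 * Real.pi - I - 4 * (ε / 4) * (2 - ξ)) / (2 * Real.pi) := by
      have : 2 * Real.pi - I - 4 * ε ≤ 2 * Real.pi - I - 4 * (ε / 4) * (2 - ξ) := by nlinarith
      gcongr
    linarith
  have hsmall : 4 * ε / (2 * Real.pi) < ε := by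
    rw [div_lt_iff₀ (by positivity)]
    nlinarith
  rw [mul_div_assoc, ← le_div_iff₀' hn', sub_div] at hlow
  rw [mul_div_assoc, ← div_le_iff₀' hn', add_div] at hup
  rw [Real.dist_eq, one_div_mul_eq_div, abs_lt]
  constructor <;> linarith
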